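/- arXiv:2410.00845 — 6 statements merged into one kernel-verified Lean document; each statement's English description precedes it below -/
import Mathlib

section
/- Let h > 0, â > 0, b̂ > 0 and θ₀ ≥ 0. Let P be the pushforward under the map w ↦ ((1 - e^{-h})/(2b̂)) · w of the noncentral chi-squared distribution χ²(2â, 2θ₀ b̂ e^{-h}/(1 - e^{-h})). Then for every real s with s(1 - e^{-h}) < b̂, the moment-generating function of P satisfies mgf(P)(s) = ((b̂ - s(1 - e^{-h}))/b̂)^{-â} · exp(θ₀ s b̂ e^{-h} / (b̂ - s(1 - e^{-h}))). (This is the one-step conditional moment-generating function of the control variate-based stochastic Cox–Ingersoll–Ross process.) -/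
open MeasureTheory ProbabilityTheory Real

/-- The noncentral chi-squared distribution `χ²(ν, μ)`, defined as the Poisson mixture
of gamma distributions `Σ_{k} (e^{-μ/2} (μ/2)^k / k!) • Gamma(ν/2 + k, 1/2)`. -/
noncomputable def noncentralChiSq (ν μ : ℝ) : Measure ℝ :=
  Measure.sum fun k : ℕ =>
    (ENNReal.ofReal (Real.exp (-μ / 2) * (μ / 2) ^ k / (Nat.factorial k))) •
      gammaMeasure (ν / 2 + k) (1 / 2)

/-- The gamma density tilted by `x ↦ exp (t * x)` is a multiple of a gamma density. -/
lemma gammaPDF_mul_ofReal_exp {a r t : ℝ} (ha : 0 < a) (hr : 0 < r) (ht : t < r) (x : ℝ) :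
    gammaPDF a r x * ENNReal.ofReal (Real.exp (t * x)) =
      ENNReal.ofReal ((r / (r - t)) ^ a) * gammaPDF a (r - t) x := by
  have hrt : 0 < r - t := sub_pos.2 ht
  have hpow : 0 < (r - t) ^ a := by positivity
  rw [gammaPDF, gammaPDF, ← ENNReal.ofReal_mul (gammaPDFReal_nonneg ha hr x),
    ← ENNReal.ofReal_mul (by positivity)]
  congr 1
  unfold gammaPDFReal
  split_ifs
  · have hexp : Real.exp (-((r - t) * x)) = Real.exp (-(r * x)) * Real.exp (t * x) := by
      rw [← Real.exp_add]
      ring_nf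
    rw [hexp, div_rpow hr.le hrt.le]
    field_simp
  · simp

/-- The exponential moments of the gamma distribution. -/
lemma lintegral_exp_mul_gammaMeasure {a r t : ℝ} (ha : 0 < a) (hr : 0 < r) (ht : t < r) :
    ∫⁻ x, ENNReal.ofReal (Real.exp (t * x)) ∂gammaMeasure a r =
      ENNReal.ofReal ((r / (r - t)) ^ a) := by
  have hpdf : ∀ b q : ℝ, Measurable (gammaPDF b q) := fun b q =>
    (measurable_gammaPDFReal b q).ennreal_ofReal
  rw [gammaMeasure, lintegral_withDensity_eq_lintegral_mul _ (hpdf a r) (by fun_prop)]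
  simp_rw [Pi.mul_apply, gammaPDF_mul_ofReal_exp ha hr ht]
  rw [lintegral_const_mul _ (hpdf a (r - t)), lintegral_gammaPDF_eq_one ha (sub_pos.2 ht), mul_one]

/-- The exponential moments of the noncentral chi-squared distribution. -/
lemma lintegral_exp_mul_noncentralChiSq {ν μ t : ℝ} (hν : 0 < ν) (hμ : 0 ≤ μ) (ht : t < 1 / 2) :
    ∫⁻ x, ENNReal.ofReal (Real.exp (t * x)) ∂noncentralChiSq ν μ =
      ENNReal.ofReal ((1 - 2 * t) ^ (-(ν / 2)) * Real.exp (μ * t / (1 - 2 * t))) := by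
  have hd : 0 < 1 - 2 * t := by linarith
  have hterm : ∀ k : ℕ,
      ∫⁻ x, ENNReal.ofReal (Real.exp (t * x)) ∂(ENNReal.ofReal
        (Real.exp (-μ / 2) * (μ / 2) ^ k / (Nat.factorial k)) •
          gammaMeasure (ν / 2 + k) (1 / 2)) =
      ENNReal.ofReal (Real.exp (-μ / 2) * (1 - 2 * t) ^ (-(ν / 2)) *
        ((μ / 2 / (1 - 2 * t)) ^ k / (Nat.factorial k))) := by
    intro k
    rw [lintegral_smul_measure, lintegral_exp_mul_gammaMeasure (by positivity) (by norm_num) ht,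
      smul_eq_mul, ← ENNReal.ofReal_mul (by positivity)]
    have hbase : (1 / 2 : ℝ) / (1 / 2 - t) = (1 - 2 * t)⁻¹ := by
      have : (1 / 2 : ℝ) - t ≠ 0 := by linarith
      field_simp
    rw [hbase, rpow_add (inv_pos.2 hd), rpow_natCast, inv_rpow hd.le, ← rpow_neg hd.le, inv_pow,
      div_pow (μ / 2) (1 - 2 * t)]
    congr 1
    ring
  have hsum : HasSum (fun k : ℕ => Real.exp (-μ / 2) * (1 - 2 * t) ^ (-(ν / 2)) *
      ((μ / 2 / (1 - 2 * t)) ^ k / (Nat.factorial k)))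
      (Real.exp (-μ / 2) * (1 - 2 * t) ^ (-(ν / 2)) * Real.exp (μ / 2 / (1 - 2 * t))) := by
    have h := NormedSpace.expSeries_div_hasSum_exp (μ / 2 / (1 - 2 * t))
    rw [← Real.exp_eq_exp_ℝ] at h
    exact h.mul_left _
  rw [noncentralChiSq, lintegral_sum_measure]
  simp_rw [hterm]
  rw [← ENNReal.ofReal_tsum_of_nonneg (fun k => by positivity) hsum.summable, hsum.tsum_eq,
    mul_right_comm, ← Real.exp_add, mul_comm]
  congr 3
  field_simp
  ring

/-- The moment-generating function of the noncentral chi-squared distribution. -/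
lemma mgf_id_noncentralChiSq {ν μ t : ℝ} (hν : 0 < ν) (hμ : 0 ≤ μ) (ht : t < 1 / 2) :
    mgf id (noncentralChiSq ν μ) t =
      (1 - 2 * t) ^ (-(ν / 2)) * Real.exp (μ * t / (1 - 2 * t)) := by
  have hd : 0 < 1 - 2 * t := by linarith
  rw [mgf, integral_eq_lintegral_of_nonneg_ae (ae_of_all _ fun x => (Real.exp_pos _).le)
    (by fun_prop)]
  simp only [id]
  rw [lintegral_exp_mul_noncentralChiSq hν hμ ht, ENNReal.toReal_ofReal (by positivity)]

/-- One-step conditional mgf of the control variate-based stochastic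
Cox–Ingersoll–Ross process: the transition is the distribution of
`((1 - e^{-h})/(2b̂)) * W` with `W ~ χ²(2â, 2θ₀ b̂ e^{-h}/(1 - e^{-h}))`. -/
theorem scirCV_one_step_mgf (h aHat bHat θ₀ : ℝ) (hh : 0 < h) (ha : 0 < aHat)
    (hb : 0 < bHat) (hθ : 0 ≤ θ₀) (s : ℝ) (hs : s * (1 - Real.exp (-h)) < bHat) :
    mgf id
      (Measure.map (fun w => ((1 - Real.exp (-h)) / (2 * bHat)) * w)
        (noncentralChiSq (2 * aHat)
          (2 * θ₀ * bHat * Real.exp (-h) / (1 - Real.exp (-h))))) s =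
      ((bHat - s * (1 - Real.exp (-h))) / bHat) ^ (-aHat) *
        Real.exp (θ₀ * s * bHat * Real.exp (-h) / (bHat - s * (1 - Real.exp (-h)))) := by
  have hq : 0 < 1 - Real.exp (-h) := by
    rw [sub_pos, Real.exp_lt_one_iff]
    linarith
  set q := 1 - Real.exp (-h)
  have hd : 0 < bHat - s * q := sub_pos.2 hs
  have ht : q / (2 * bHat) * s < 1 / 2 := by
    rw [div_mul_eq_mul_div, div_lt_div_iff₀ (by positivity) (by norm_num)]
    linarith
  have hbase : 1 - 2 * (q / (2 * bHat) * s) = (bHat - s * q) / bHat := by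
    field_simp
  rw [mgf_id_map (by fun_prop)]
  change mgf (fun w => q / (2 * bHat) * id w) _ s = _
  rw [mgf_const_mul, mgf_id_noncentralChiSq (by positivity) (by positivity) ht, hbase,
    mul_div_cancel_left₀ aHat two_ne_zero]
  congr 2
  field_simp
end

section
/- Let M ≥ 1 be an integer, h > 0, and b₁, …, b_M be nonzero real numbers. For 1 ≤ j ≤ M define r_j(s) = s b_j e^{-h} / (b_j − s(1 − e^{-h})), and for 1 ≤ j ≤ M + 1 define D_j(s) = 1 − s(1 − e^{-h}) Σ_{l=1}^{M−j+1} e^{-(l−1)h} / b_{M−l+1} (so D_{M+1}(s) = 1). Fix 1 ≤ m ≤ M and a real s such that D_j(s) ≠ 0 for all m ≤ j ≤ M + 1. Then the composition satisfies (r_m ∘ r_{m+1} ∘ ⋯ ∘ r_M)(s) = s e^{-(M−m+1)h} / D_m(s). -/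
open Finset Real

/-- One-step map of the control variate-based stochastic Cox–Ingersoll–Ross process
(main parametrization): `r_j(s) = s b_j e^{-h} / (b_j − s(1 − e^{-h}))`. -/
noncomputable def scirR (h : ℝ) (b : ℕ → ℝ) (j : ℕ) (s : ℝ) : ℝ :=
  s * b j * Real.exp (-h) / (b j - s * (1 - Real.exp (-h)))

/-- Denominator `D_j(s) = 1 − s(1 − e^{-h}) Σ_{l=1}^{M−j+1} e^{-(l−1)h} / b_{M−l+1}`,
with the convention `D_{M+1}(s) = 1` (empty sum). -/
noncomputable def scirD (h : ℝ) (b : ℕ → ℝ) (M j : ℕ) (s : ℝ) : ℝ :=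
  1 - s * (1 - Real.exp (-h)) *
      ∑ l ∈ Finset.Icc 1 (M + 1 - j), Real.exp (-((l : ℝ) - 1) * h) / b (M - l + 1)

/-- `iterComp r j k s = r_j (r_{j+1} (⋯ (r_{j+k-1} s)))`: the composition of `k`
consecutive one-step maps starting at index `j`, applied to `s`. -/
def iterComp (r : ℕ → ℝ → ℝ) : ℕ → ℕ → ℝ → ℝ
  | _, 0, s => s
  | j, k + 1, s => r j (iterComp r (j + 1) k s)

theorem scirD_eq_scirD_succ_sub (h : ℝ) (b : ℕ → ℝ) {M j : ℕ} (hj1 : 1 ≤ j) (hj : j ≤ M)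
    (s : ℝ) :
    scirD h b M j s = scirD h b M (j + 1) s -
      s * (1 - Real.exp (-h)) * (Real.exp (-((M - j : ℕ) : ℝ) * h) / b j) := by
  obtain ⟨k, rfl⟩ := Nat.exists_eq_add_of_le hj
  have h1 : j + k + 1 - j = k + 1 := by omega
  have h2 : j + k + 1 - (j + 1) = k := by omega
  have h3 : j + k - (k + 1) + 1 = j := by omega
  have h4 : j + k - j = k := by omega
  rw [scirD, scirD, h1, h2, h4, Finset.sum_Icc_succ_top (by omega), h3]
  push_cast
  rw [add_sub_cancel_right]
  ring

theorem iterComp_scirR (h : ℝ) (b : ℕ → ℝ) (M : ℕ) (s : ℝ)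
    (hb : ∀ j, 1 ≤ j → j ≤ M → b j ≠ 0) (k j : ℕ) (hj : 1 ≤ j) (hjk : j + k = M + 1)
    (hD : ∀ i, j ≤ i → i ≤ M + 1 → scirD h b M i s ≠ 0) :
    iterComp (scirR h b) j k s = s * Real.exp (-(k : ℝ) * h) / scirD h b M j s := by
  induction k generalizing j with
  | zero =>
    obtain rfl : j = M + 1 := by omega
    simp [iterComp, scirD]
  | succ k ih =>
    have hbj := hb j hj (by omega)
    have hDj := hD j le_rfl (by omega)
    have hDs := hD (j + 1) (by omega) (by omega)
    have hrec := scirD_eq_scirD_succ_sub h b hj (by omega : j ≤ M) s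
    rw [show M - j = k by omega] at hrec
    have hexp : Real.exp (-((k + 1 : ℕ) : ℝ) * h) =
        Real.exp (-(k : ℝ) * h) * Real.exp (-h) := by
      rw [← Real.exp_add]
      push_cast
      ring_nf
    rw [iterComp, ih (j + 1) (by omega) (by omega) fun i hi => hD i (by omega), scirR, hexp]
    have hden : b j - s * Real.exp (-(k : ℝ) * h) / scirD h b M (j + 1) s *
        (1 - Real.exp (-h)) = b j * scirD h b M j s / scirD h b M (j + 1) s := by
      rw [hrec]
      field_simp
    rw [hden]
    field_simp

theorem scirR_comp (M : ℕ) (hM : 1 ≤ M) (h : ℝ) (hh : 0 < h) (b : ℕ → ℝ)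
    (hb : ∀ j, 1 ≤ j → j ≤ M → b j ≠ 0) (m : ℕ) (hm1 : 1 ≤ m) (hm2 : m ≤ M) (s : ℝ)
    (hD : ∀ j, m ≤ j → j ≤ M + 1 → scirD h b M j s ≠ 0) :
    iterComp (scirR h b) m (M - m + 1) s =
      s * Real.exp (-((M - m + 1 : ℕ) : ℝ) * h) / scirD h b M m s := by
  exact iterComp_scirR h b M s hb (M - m + 1) m hm1 (by omega) hD
end

section
/- Let M ≥ 1 be an integer, h > 0, θ₀ ≥ 0, a₁, …, a_M reals and b₁, …, b_M positive reals, with r_j, D_j, ρ_j as in the main parametrization. Then the cumulant function K(s) = θ₀ ρ₁(s) − Σ_{m=1}^{M} a_m · log(D_m(s)/D_{m+1}(s)) has derivative at s = 0 equal to K′(0) = θ₀ e^{-Mh} + (1 − e^{-h}) Σ_{m=1}^{M} (a_m / b_m) e^{-(M−m)h}. -/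
open Finset Real

/-- Cumulant function `K(s) = θ₀ ρ₁(s) − Σ_{m=1}^{M} a_m log(D_m(s)/D_{m+1}(s))`
of the `M`-step control variate-based stochastic Cox–Ingersoll–Ross process
(main parametrization), where `ρ₁ = r₁ ∘ ⋯ ∘ r_M`. -/
noncomputable def scirK (h θ₀ : ℝ) (a b : ℕ → ℝ) (M : ℕ) (s : ℝ) : ℝ :=
  θ₀ * iterComp (scirR h b) 1 M s -
    ∑ m ∈ Finset.Icc 1 M, a m * Real.log (scirD h b M m s / scirD h b M (m + 1) s)

theorem scirR_zero (h : ℝ) (b : ℕ → ℝ) (j : ℕ) : scirR h b j 0 = 0 := by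
  simp [scirR]

theorem hasDerivAt_scirR_zero (h : ℝ) (b : ℕ → ℝ) (j : ℕ) (hb : b j ≠ 0) :
    HasDerivAt (scirR h b j) (Real.exp (-h)) 0 := by
  have hnum : HasDerivAt (fun s : ℝ => s * b j * Real.exp (-h)) (1 * b j * Real.exp (-h)) 0 :=
    ((hasDerivAt_id (0 : ℝ)).mul_const _).mul_const _
  have hden : HasDerivAt (fun s : ℝ => b j - s * (1 - Real.exp (-h)))
      (-(1 * (1 - Real.exp (-h)))) 0 :=
    ((hasDerivAt_id (0 : ℝ)).mul_const _).const_sub _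
  refine (hnum.div hden (by simpa using hb)).congr_deriv ?_
  simp only [zero_mul, sub_zero]
  field_simp

theorem iterComp_zero_of_fixed (r : ℕ → ℝ → ℝ) (hr : ∀ j, r j 0 = 0) (j k : ℕ) :
    iterComp r j k 0 = 0 := by
  induction k generalizing j with
  | zero => rfl
  | succ k ih => rw [iterComp, ih, hr]

theorem hasDerivAt_iterComp_zero (r : ℕ → ℝ → ℝ) (c : ℝ) (hr : ∀ j, r j 0 = 0) (j k : ℕ)
    (hd : ∀ i, j ≤ i → i < j + k → HasDerivAt (r i) c 0) :
    HasDerivAt (iterComp r j k) (c ^ k) 0 := by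
  induction k generalizing j with
  | zero => exact (hasDerivAt_id (0 : ℝ)).congr_deriv (pow_zero c).symm
  | succ k ih =>
    have hin := ih (j + 1) fun i h₁ h₂ => hd i (by omega) (by omega)
    have hout : HasDerivAt (r j) c (iterComp r (j + 1) k 0) := by
      rw [iterComp_zero_of_fixed r hr]
      exact hd j le_rfl (by omega)
    rw [pow_succ']
    exact hout.comp 0 hin

theorem scirD_zero (h : ℝ) (b : ℕ → ℝ) (M j : ℕ) : scirD h b M j 0 = 1 := by
  simp [scirD]

theorem hasDerivAt_scirD (h : ℝ) (b : ℕ → ℝ) (M j : ℕ) (s : ℝ) :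
    HasDerivAt (scirD h b M j)
      (-((1 - Real.exp (-h)) *
        ∑ l ∈ Finset.Icc 1 (M + 1 - j), Real.exp (-((l : ℝ) - 1) * h) / b (M - l + 1))) s := by
  have hd := (((hasDerivAt_id s).mul_const (1 - Real.exp (-h))).mul_const
    (∑ l ∈ Finset.Icc 1 (M + 1 - j),
      Real.exp (-((l : ℝ) - 1) * h) / b (M - l + 1))).const_sub 1
  rw [one_mul] at hd
  exact hd

theorem hasDerivAt_log_scirD_div_zero (h : ℝ) (b : ℕ → ℝ) (M m : ℕ) (h1 : 1 ≤ m) (hm : m ≤ M) :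
    HasDerivAt (fun s => Real.log (scirD h b M m s / scirD h b M (m + 1) s))
      (-((1 - Real.exp (-h)) * (Real.exp (-((M : ℝ) - (m : ℝ)) * h) / b m))) 0 := by
  have hd := ((hasDerivAt_scirD h b M m 0).div (hasDerivAt_scirD h b M (m + 1) 0)
    (by simp [scirD_zero])).log (by simp [scirD_zero])
  refine hd.congr_deriv ?_
  obtain ⟨d, rfl⟩ := Nat.exists_eq_add_of_le hm
  have e₁ : m + d + 1 - m = d + 1 := by omega
  have e₂ : m + d + 1 - (m + 1) = d := by omega
  have e₃ : m + d - (d + 1) + 1 = m := by omega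
  simp only [Pi.div_apply, scirD_zero, e₁, e₂, Finset.sum_Icc_succ_top (Nat.le_add_left 1 d), e₃]
  push_cast
  rw [add_sub_cancel_right, add_sub_cancel_left]
  ring

theorem scirK_hasDerivAt_zero (M : ℕ) (hM : 1 ≤ M) (h θ₀ : ℝ) (hh : 0 < h) (hθ : 0 ≤ θ₀)
    (a b : ℕ → ℝ) (hb : ∀ j, 1 ≤ j → j ≤ M → 0 < b j) :
    HasDerivAt (scirK h θ₀ a b M)
      (θ₀ * Real.exp (-(M : ℝ) * h) +
        (1 - Real.exp (-h)) *
          ∑ m ∈ Finset.Icc 1 M, (a m / b m) * Real.exp (-((M : ℝ) - (m : ℝ)) * h)) 0 := by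
  have hρ : HasDerivAt (iterComp (scirR h b) 1 M) (Real.exp (-(M : ℝ) * h)) 0 := by
    have hpow : Real.exp (-(M : ℝ) * h) = Real.exp (-h) ^ M := by
      rw [← Real.exp_nat_mul]
      ring_nf
    rw [hpow]
    exact hasDerivAt_iterComp_zero _ _ (scirR_zero h b) 1 M fun i h₁ h₂ =>
      hasDerivAt_scirR_zero h b i (hb i h₁ (by omega)).ne'
  have hlog := HasDerivAt.fun_sum fun m (hm : m ∈ Finset.Icc 1 M) =>
    (hasDerivAt_log_scirD_div_zero h b M m (Finset.mem_Icc.1 hm).1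
      (Finset.mem_Icc.1 hm).2).const_mul (a m)
  refine ((hρ.const_mul θ₀).sub hlog).congr_deriv ?_
  rw [sub_eq_add_neg, ← Finset.sum_neg_distrib, Finset.mul_sum]
  congr 1
  refine Finset.sum_congr rfl fun m _ => ?_
  ring
end

section
/- Let M ≥ 1 be an integer, h > 0, θ₀ ≥ 0, a₁, …, a_M reals and b₁, …, b_M positive reals, with r_j, D_j, ρ_j as in the main parametrization and K(s) = θ₀ ρ₁(s) − Σ_{m=1}^{M} a_m · log(D_m(s)/D_{m+1}(s)). Then the second derivative of K at s = 0 equals K″(0) = 2 θ₀ e^{-Mh} (1 − e^{-h}) Σ_{l=1}^{M} e^{-(l−1)h}/b_{M−l+1} + (1 − e^{-h})² Σ_{m=1}^{M} (a_m / b_m²) e^{-2(M−m)h} + 2 (1 − e^{-h})² Σ_{m=1}^{M−1} e^{-(M−m)h} (a_m / b_m) Σ_{l=1}^{M−m} e^{-(l−1)h}/b_{M−l+1}. -/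
open Finset Real

/-- The sum `Σ_{l=1}^{n} e^{-(l−1)h} / b_{M−l+1}` occurring in the denominators `D_j`. -/
noncomputable def scirS (h : ℝ) (b : ℕ → ℝ) (M n : ℕ) : ℝ :=
  ∑ l ∈ Finset.Icc 1 n, Real.exp (-((l : ℝ) - 1) * h) / b (M - l + 1)

theorem scirS_succ (h : ℝ) (b : ℕ → ℝ) (M n : ℕ) :
    scirS h b M (n + 1) = scirS h b M n + Real.exp (-(n : ℝ) * h) / b (M - (n + 1) + 1) := by
  unfold scirS
  rw [Finset.sum_Icc_succ_top (by omega)]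
  rw [Nat.cast_succ, add_sub_cancel_right]

theorem scirD_eq (h : ℝ) (b : ℕ → ℝ) (M j : ℕ) (s : ℝ) :
    scirD h b M j s = 1 - (1 - Real.exp (-h)) * scirS h b M (M + 1 - j) * s := by
  unfold scirD scirS
  ring

/-- Closed form of the composition `r_{M-k+1} ∘ ⋯ ∘ r_M`. -/
theorem iterComp_scirR_eq {h : ℝ} {b : ℕ → ℝ} {M : ℕ} (hb : ∀ j, 1 ≤ j → j ≤ M → b j ≠ 0)
    {s : ℝ} (hs : ∀ n ≤ M, 1 - (1 - Real.exp (-h)) * scirS h b M n * s ≠ 0) :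
    ∀ k ≤ M, iterComp (scirR h b) (M + 1 - k) k s =
      Real.exp (-(k : ℝ) * h) * (s / (1 - (1 - Real.exp (-h)) * scirS h b M k * s)) := by
  intro k
  induction k with
  | zero => simp [iterComp, scirS]
  | succ k ih =>
    intro hk
    have hj : M + 1 - (k + 1) + 1 = M + 1 - k := by omega
    have hj' : M - (k + 1) + 1 = M + 1 - (k + 1) := by omega
    have hD := hs k (by omega)
    have hD' := hs (k + 1) hk
    have hbj := hb (M + 1 - (k + 1)) (by omega) (by omega)
    have hexp : Real.exp (-((k + 1 : ℕ) : ℝ) * h) = Real.exp (-(k : ℝ) * h) * Real.exp (-h) := by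
      rw [← Real.exp_add]
      push_cast
      ring_nf
    rw [iterComp, hj, ih (by omega), scirR, hexp]
    rw [scirS_succ, hj'] at hD' ⊢
    generalize b (M + 1 - (k + 1)) = β at *
    generalize Real.exp (-(k : ℝ) * h) = p at *
    generalize Real.exp (-h) = q at *
    generalize scirS h b M k = S at *
    have hD'_eq : 1 - (1 - q) * (S + p / β) * s = 1 - (1 - q) * S * s - (1 - q) * (p / β) * s := by
      ring
    rw [hD'_eq] at hD' ⊢
    generalize 1 - (1 - q) * S * s = D at *
    have hden : β - p * (s / D) * (1 - q) = β * (D - (1 - q) * (p / β) * s) / D := by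
      field_simp
    rw [hden]
    generalize D - (1 - q) * (p / β) * s = D' at *
    field_simp

theorem hasDerivAt_one_sub_mul (u x : ℝ) : HasDerivAt (fun s : ℝ => 1 - u * s) (-u) x := by
  simpa using ((hasDerivAt_id x).const_mul u).const_sub 1

theorem hasDerivAt_div_one_sub_mul {u x : ℝ} (hu : 1 - u * x ≠ 0) :
    HasDerivAt (fun s : ℝ => s / (1 - u * s)) (((1 - u * x) ^ 2)⁻¹) x := by
  refine ((hasDerivAt_id x).fun_div (hasDerivAt_one_sub_mul u x) hu).congr_deriv ?_
  rw [inv_eq_one_div, id]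
  congr 1
  ring

theorem hasDerivAt_log_one_sub_mul_div {u v x : ℝ} (hu : 1 - u * x ≠ 0) (hv : 1 - v * x ≠ 0) :
    HasDerivAt (fun s : ℝ => Real.log ((1 - u * s) / (1 - v * s)))
      (v * (1 - v * x)⁻¹ - u * (1 - u * x)⁻¹) x := by
  refine (((hasDerivAt_one_sub_mul u x).fun_div (hasDerivAt_one_sub_mul v x) hv).log
    (div_ne_zero hu hv)).congr_deriv ?_
  generalize 1 - u * x = U at *
  generalize 1 - v * x = V at *
  field_simp
  ring

theorem hasDerivAt_mul_inv_one_sub_mul_zero (u : ℝ) :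
    HasDerivAt (fun s : ℝ => u * (1 - u * s)⁻¹) (u ^ 2) 0 := by
  refine (((hasDerivAt_one_sub_mul u 0).fun_inv (by simp)).const_mul u).congr_deriv ?_
  simp
  ring

theorem hasDerivAt_inv_sq_one_sub_mul_zero (u : ℝ) :
    HasDerivAt (fun s : ℝ => ((1 - u * s) ^ 2)⁻¹) (2 * u) 0 := by
  refine (((hasDerivAt_one_sub_mul u 0).fun_pow 2).fun_inv (by simp)).congr_deriv ?_
  simp

theorem iteratedDeriv_two_eq_of_hasDerivAt {f f' : ℝ → ℝ} {x v : ℝ}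
    (hf : ∀ᶠ s in nhds x, HasDerivAt f (f' s) s) (hf' : HasDerivAt f' v x) :
    iteratedDeriv 2 f x = v := by
  rw [iteratedDeriv_succ, iteratedDeriv_one]
  have : deriv f =ᶠ[nhds x] f' := hf.mono fun s hs => hs.deriv
  rw [this.deriv_eq, hf'.deriv]

/-- The second derivative at `0` in terms of the coefficients of the linear functions `D_j`. -/
theorem iteratedDeriv_two_scirK (M : ℕ) (h θ₀ : ℝ) (a b : ℕ → ℝ)
    (hb : ∀ j, 1 ≤ j → j ≤ M → b j ≠ 0) :
    iteratedDeriv 2 (scirK h θ₀ a b M) 0 =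
      θ₀ * (Real.exp (-(M : ℝ) * h) * (2 * ((1 - Real.exp (-h)) * scirS h b M M))) -
        ∑ m ∈ Finset.Icc 1 M, a m * (((1 - Real.exp (-h)) * scirS h b M (M - m)) ^ 2 -
          ((1 - Real.exp (-h)) * scirS h b M (M + 1 - m)) ^ 2) := by
  set u : ℕ → ℝ := fun n => (1 - Real.exp (-h)) * scirS h b M n with hu
  have hne : ∀ᶠ s in nhds (0 : ℝ), ∀ n ≤ M, 1 - u n * s ≠ 0 := by
    have : ∀ n ∈ Set.Iic M, ∀ᶠ s in nhds (0 : ℝ), 1 - u n * s ≠ 0 := fun n _ =>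
      (hasDerivAt_one_sub_mul (u n) 0).continuousAt.eventually_ne (by simp)
    simpa using (Filter.eventually_all_finite (Set.finite_Iic M)).2 this
  have hK : ∀ᶠ s in nhds (0 : ℝ), scirK h θ₀ a b M s =
      θ₀ * (Real.exp (-(M : ℝ) * h) * (s / (1 - u M * s))) -
        ∑ m ∈ Finset.Icc 1 M, a m * Real.log ((1 - u (M + 1 - m) * s) / (1 - u (M - m) * s)) := by
    filter_upwards [hne] with s hs
    have hcomp := iterComp_scirR_eq hb hs M le_rfl
    rw [Nat.add_sub_cancel_left] at hcomp
    simp only [scirK, hcomp, scirD_eq, Nat.add_sub_add_right, hu]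
  rw [Filter.EventuallyEq.iteratedDeriv_eq 2 hK]
  refine iteratedDeriv_two_eq_of_hasDerivAt
    (f' := fun s => θ₀ * (Real.exp (-(M : ℝ) * h) * ((1 - u M * s) ^ 2)⁻¹) -
      ∑ m ∈ Finset.Icc 1 M, a m * (u (M - m) * (1 - u (M - m) * s)⁻¹ -
        u (M + 1 - m) * (1 - u (M + 1 - m) * s)⁻¹)) ?_ ?_
  · filter_upwards [hne] with s hs
    refine (((hasDerivAt_div_one_sub_mul (hs M le_rfl)).const_mul _).const_mul _).fun_sub
      (HasDerivAt.fun_sum fun m hm => ?_)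
    rw [Finset.mem_Icc] at hm
    exact (hasDerivAt_log_one_sub_mul_div (hs _ (by omega)) (hs _ (by omega))).const_mul _
  · exact (((hasDerivAt_inv_sq_one_sub_mul_zero _).const_mul _).const_mul _).fun_sub
      (HasDerivAt.fun_sum fun m _ => ((hasDerivAt_mul_inv_one_sub_mul_zero _).fun_sub
        (hasDerivAt_mul_inv_one_sub_mul_zero _)).const_mul _)

theorem scirK_second_deriv_zero (M : ℕ) (hM : 1 ≤ M) (h θ₀ : ℝ) (hh : 0 < h) (hθ : 0 ≤ θ₀)
    (a b : ℕ → ℝ) (hb : ∀ j, 1 ≤ j → j ≤ M → 0 < b j) :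
    iteratedDeriv 2 (scirK h θ₀ a b M) 0 =
      2 * θ₀ * Real.exp (-(M : ℝ) * h) * (1 - Real.exp (-h)) *
          ∑ l ∈ Finset.Icc 1 M, Real.exp (-((l : ℝ) - 1) * h) / b (M - l + 1) +
        (1 - Real.exp (-h)) ^ 2 *
          ∑ m ∈ Finset.Icc 1 M, (a m / (b m) ^ 2) * Real.exp (-2 * ((M : ℝ) - (m : ℝ)) * h) +
        2 * (1 - Real.exp (-h)) ^ 2 *
          ∑ m ∈ Finset.Icc 1 (M - 1), Real.exp (-((M : ℝ) - (m : ℝ)) * h) * (a m / b m) *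
            ∑ l ∈ Finset.Icc 1 (M - m), Real.exp (-((l : ℝ) - 1) * h) / b (M - l + 1) := by
  rw [iteratedDeriv_two_scirK M h θ₀ a b fun j h1 h2 => (hb j h1 h2).ne']
  change _ = 2 * θ₀ * Real.exp (-(M : ℝ) * h) * (1 - Real.exp (-h)) * scirS h b M M + _ +
    2 * (1 - Real.exp (-h)) ^ 2 * ∑ m ∈ Finset.Icc 1 (M - 1),
      Real.exp (-((M : ℝ) - (m : ℝ)) * h) * (a m / b m) * scirS h b M (M - m)
  have hext : ∑ m ∈ Finset.Icc 1 (M - 1),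
        Real.exp (-((M : ℝ) - (m : ℝ)) * h) * (a m / b m) * scirS h b M (M - m) =
      ∑ m ∈ Finset.Icc 1 M,
        Real.exp (-((M : ℝ) - (m : ℝ)) * h) * (a m / b m) * scirS h b M (M - m) := by
    obtain ⟨N, rfl⟩ : ∃ N, M = N + 1 := ⟨M - 1, by omega⟩
    rw [Finset.sum_Icc_succ_top (by omega)]
    simp [scirS]
  rw [hext, add_assoc, Finset.mul_sum, Finset.mul_sum, ← Finset.sum_add_distrib, sub_eq_add_neg,
    ← Finset.sum_neg_distrib]
  congr 1
  · ring
  refine Finset.sum_congr rfl fun m hm => ?_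
  rw [Finset.mem_Icc] at hm
  have hsucc : M + 1 - m = M - m + 1 := by omega
  have hidx : M - (M - m + 1) + 1 = m := by omega
  have hexp : Real.exp (-2 * ((M : ℝ) - (m : ℝ)) * h) =
      Real.exp (-((M : ℝ) - (m : ℝ)) * h) ^ 2 := by
    rw [← Real.exp_nat_mul]
    push_cast
    ring_nf
  rw [hsucc, scirS_succ, hidx, Nat.cast_sub hm.2, hexp]
  ring
end

section
/- Let a > 0, t > 0 and θ₀ ≥ 0, and let P be the pushforward under the map w ↦ ((1 − e^{-t})/2) · w of the noncentral chi-squared distribution χ²(2a, 2θ₀ e^{-t}/(1 − e^{-t})) (the exact Cox–Ingersoll–Ross transition over time t with b = 1, σ² = 2 started at θ₀). Then ∫ x dP(x) = θ₀ e^{-t} + a(1 − e^{-t}) and the variance of P equals 2 θ₀ (e^{-t} − e^{-2t}) + a (1 − e^{-t})². -/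
open MeasureTheory ProbabilityTheory Real

/-- The exact Cox–Ingersoll–Ross transition over time `t` with `b = 1`, `σ² = 2`,
started at `θ₀`: the distribution of `((1 − e^{-t})/2) W` with
`W ~ χ²(2a, 2θ₀ e^{-t}/(1 − e^{-t}))`. -/
noncomputable def cirTransition (a t θ₀ : ℝ) : Measure ℝ :=
  Measure.map (fun w => ((1 - Real.exp (-t)) / 2) * w)
    (noncentralChiSq (2 * a) (2 * θ₀ * Real.exp (-t) / (1 - Real.exp (-t))))

section GammaMoments

variable {a r : ℝ}

lemma measurable_gammaPDF (a r : ℝ) : Measurable (gammaPDF a r) :=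
  (measurable_gammaPDFReal a r).ennreal_ofReal

lemma gammaPDFReal_mul_self (ha : 0 < a) (hr : 0 < r) (x : ℝ) :
    gammaPDFReal a r x * x = a / r * gammaPDFReal (a + 1) r x := by
  unfold gammaPDFReal
  split_ifs with hx
  · have hΓ : Gamma a ≠ 0 := (Gamma_pos_of_pos ha).ne'
    have hpow : x ^ (a - 1) * x = x ^ a := by
      rcases hx.eq_or_lt with rfl | hx
      · simp [zero_rpow ha.ne']
      · rw [← rpow_add_one hx.ne', sub_add_cancel]
    rw [Gamma_add_one ha.ne', rpow_add_one hr.ne', add_sub_cancel_right, ← hpow]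
    field_simp
  · simp

lemma integrable_gammaMeasure_iff (ha : 0 < a) (hr : 0 < r) {f : ℝ → ℝ} :
    Integrable f (gammaMeasure a r) ↔ Integrable (fun x ↦ gammaPDFReal a r x * f x) := by
  rw [gammaMeasure, integrable_withDensity_iff_integrable_smul'
    (measurable_gammaPDF a r) (by simp [gammaPDF])]
  simp [gammaPDF, ENNReal.toReal_ofReal, gammaPDFReal_nonneg ha hr]

lemma integral_gammaMeasure (ha : 0 < a) (hr : 0 < r) (f : ℝ → ℝ) :
    ∫ x, f x ∂(gammaMeasure a r) = ∫ x, gammaPDFReal a r x * f x := by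
  rw [gammaMeasure, integral_withDensity_eq_integral_toReal_smul
    (measurable_gammaPDF a r) (by simp [gammaPDF])]
  simp [gammaPDF, ENNReal.toReal_ofReal, gammaPDFReal_nonneg ha hr]

lemma ae_nonneg_gammaMeasure (a r : ℝ) : ∀ᵐ x ∂(gammaMeasure a r), 0 ≤ x := by
  rw [gammaMeasure, ae_withDensity_iff (measurable_gammaPDF a r)]
  refine ae_of_all _ fun x hx ↦ ?_
  contrapose! hx
  exact gammaPDF_of_neg hx

lemma integrable_self_mul_gammaMeasure (ha : 0 < a) (hr : 0 < r) {f : ℝ → ℝ}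
    (hf : Integrable f (gammaMeasure (a + 1) r)) :
    Integrable (fun x ↦ x * f x) (gammaMeasure a r) := by
  rw [integrable_gammaMeasure_iff ha hr]
  rw [integrable_gammaMeasure_iff (by positivity) hr] at hf
  simpa only [← mul_assoc, gammaPDFReal_mul_self ha hr] using hf.const_mul (a / r)

lemma integral_self_mul_gammaMeasure (ha : 0 < a) (hr : 0 < r) (f : ℝ → ℝ) :
    ∫ x, x * f x ∂(gammaMeasure a r) = a / r * ∫ x, f x ∂(gammaMeasure (a + 1) r) := by
  rw [integral_gammaMeasure ha hr, integral_gammaMeasure (by positivity) hr,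
    ← integral_const_mul]
  simp only [← mul_assoc, gammaPDFReal_mul_self ha hr]

lemma integrable_pow_gammaMeasure (ha : 0 < a) (hr : 0 < r) (n : ℕ) :
    Integrable (fun x ↦ x ^ n) (gammaMeasure a r) := by
  induction n generalizing a with
  | zero =>
    have := isProbabilityMeasure_gammaMeasure ha hr
    simp
  | succ n ih =>
    simpa only [pow_succ'] using
      integrable_self_mul_gammaMeasure ha hr (ih (a := a + 1) (by positivity))

lemma integral_id_gammaMeasure (ha : 0 < a) (hr : 0 < r) :
    ∫ x, x ∂(gammaMeasure a r) = a / r := by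
  have := isProbabilityMeasure_gammaMeasure (a := a + 1) (by positivity) hr
  simpa using integral_self_mul_gammaMeasure ha hr (fun _ ↦ 1)

lemma integral_sq_gammaMeasure (ha : 0 < a) (hr : 0 < r) :
    ∫ x, x ^ 2 ∂(gammaMeasure a r) = a * (a + 1) / r ^ 2 := by
  simp only [sq]
  rw [integral_self_mul_gammaMeasure ha hr, integral_id_gammaMeasure (by positivity) hr]
  field_simp

end GammaMoments

section PoissonMoments

lemma hasSum_poisson (l : ℝ) :
    HasSum (fun k : ℕ ↦ exp (-l) * l ^ k / k.factorial) 1 := by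
  have h := (NormedSpace.expSeries_div_hasSum_exp l).mul_left (exp (-l))
  rw [← exp_eq_exp_ℝ, ← exp_add, neg_add_cancel, exp_zero] at h
  simpa only [mul_div_assoc] using h

lemma hasSum_poisson_natCast_mul {l s : ℝ} {f : ℕ → ℝ}
    (h : HasSum (fun k : ℕ ↦ exp (-l) * l ^ k / k.factorial * f (k + 1)) s) :
    HasSum (fun k : ℕ ↦ exp (-l) * l ^ k / k.factorial * (k * f k)) (l * s) := by
  rw [← hasSum_nat_add_iff' 1]
  simp only [Finset.range_one, Finset.sum_singleton, Nat.cast_zero, zero_mul, mul_zero, sub_zero]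
  refine (h.mul_left l).congr_fun fun k ↦ ?_
  rw [Nat.factorial_succ]
  push_cast
  field_simp
  ring

lemma hasSum_poisson_mul_natCast (l : ℝ) :
    HasSum (fun k : ℕ ↦ exp (-l) * l ^ k / k.factorial * k) l := by
  simpa using hasSum_poisson_natCast_mul (s := 1) (f := fun _ ↦ 1) (by simpa using hasSum_poisson l)

lemma hasSum_poisson_mul_natCast_sq (l : ℝ) :
    HasSum (fun k : ℕ ↦ exp (-l) * l ^ k / k.factorial * (k : ℝ) ^ 2) (l * (l + 1)) := by
  simp only [sq]
  refine hasSum_poisson_natCast_mul (f := fun k ↦ (k : ℝ)) ?_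
  simpa [mul_add] using (hasSum_poisson_mul_natCast l).add (hasSum_poisson l)

end PoissonMoments

section NoncentralChiSq

variable {ν μ : ℝ}

lemma integrable_and_integral_pow_noncentralChiSq (hν : 0 < ν) (hμ : 0 ≤ μ) (n : ℕ) {m : ℝ}
    (h : HasSum (fun k : ℕ ↦ exp (-(μ / 2)) * (μ / 2) ^ k / k.factorial *
      ∫ x, x ^ n ∂(gammaMeasure (ν / 2 + k) (1 / 2))) m) :
    Integrable (fun x ↦ x ^ n) (noncentralChiSq ν μ) ∧
      ∫ x, x ^ n ∂(noncentralChiSq ν μ) = m := by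
  have hw (k : ℕ) : 0 ≤ exp (-(μ / 2)) * (μ / 2) ^ k / k.factorial := by positivity
  have hint : Integrable (fun x ↦ x ^ n) (noncentralChiSq ν μ) := by
    refine integrable_sum_measure (fun k ↦ (integrable_pow_gammaMeasure (by positivity)
      (by norm_num) n).smul_measure ENNReal.ofReal_ne_top) (h.summable.congr fun k ↦ ?_)
    rw [integral_smul_measure, neg_div, ENNReal.toReal_ofReal (hw k), smul_eq_mul]
    congr 1
    refine integral_congr_ae ((ae_nonneg_gammaMeasure _ _).mono fun x hx ↦ ?_)
    simp [abs_of_nonneg hx]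
  refine ⟨hint, (hasSum_integral_measure hint).unique (h.congr_fun fun k ↦ ?_)⟩
  rw [integral_smul_measure, neg_div, ENNReal.toReal_ofReal (hw k), smul_eq_mul]

lemma isProbabilityMeasure_noncentralChiSq (hν : 0 < ν) (hμ : 0 ≤ μ) :
    IsProbabilityMeasure (noncentralChiSq ν μ) := by
  have hg (k : ℕ) : IsProbabilityMeasure (gammaMeasure (ν / 2 + k) (1 / 2)) :=
    isProbabilityMeasure_gammaMeasure (by positivity) (by norm_num)
  obtain ⟨hi, h⟩ := integrable_and_integral_pow_noncentralChiSq hν hμ 0 (m := 1)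
    (by simpa only [pow_zero, integral_const, probReal_univ, smul_eq_mul, mul_one]
      using hasSum_poisson (μ / 2))
  have : IsFiniteMeasure (noncentralChiSq ν μ) := by
    simpa [integrable_const_iff] using hi
  exact isProbabilityMeasure_iff_real.mpr (by simpa using h)

lemma integrable_and_integral_id_noncentralChiSq (hν : 0 < ν) (hμ : 0 ≤ μ) :
    Integrable (fun x ↦ x) (noncentralChiSq ν μ) ∧ ∫ x, x ∂(noncentralChiSq ν μ) = ν + μ := by
  simpa using integrable_and_integral_pow_noncentralChiSq hν hμ 1 (m := ν + μ) <| by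
    have h := ((hasSum_poisson (μ / 2)).mul_left ν).add
      ((hasSum_poisson_mul_natCast (μ / 2)).mul_left 2)
    convert! h using 1
    · funext k
      simp only [pow_one]
      rw [integral_id_gammaMeasure (by positivity) (by norm_num)]
      ring
    · ring

lemma integrable_and_integral_sq_noncentralChiSq (hν : 0 < ν) (hμ : 0 ≤ μ) :
    Integrable (fun x ↦ x ^ 2) (noncentralChiSq ν μ) ∧
      ∫ x, x ^ 2 ∂(noncentralChiSq ν μ) = (ν + μ) ^ 2 + 2 * (ν + 2 * μ) := by
  refine integrable_and_integral_pow_noncentralChiSq hν hμ 2 ?_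
  have h := (((hasSum_poisson (μ / 2)).mul_left (ν ^ 2 + 2 * ν)).add
    ((hasSum_poisson_mul_natCast (μ / 2)).mul_left (4 * ν + 4))).add
      ((hasSum_poisson_mul_natCast_sq (μ / 2)).mul_left 4)
  convert! h using 1
  · funext k
    rw [integral_sq_gammaMeasure (by positivity) (by norm_num)]
    ring
  · ring

lemma integral_sub_sq_noncentralChiSq (hν : 0 < ν) (hμ : 0 ≤ μ) :
    ∫ x, (x - (ν + μ)) ^ 2 ∂(noncentralChiSq ν μ) = 2 * (ν + 2 * μ) := by
  have := isProbabilityMeasure_noncentralChiSq hν hμ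
  obtain ⟨hi₁, h₁⟩ := integrable_and_integral_id_noncentralChiSq hν hμ
  obtain ⟨hi₂, h₂⟩ := integrable_and_integral_sq_noncentralChiSq hν hμ
  have hexp (x : ℝ) : (x - (ν + μ)) ^ 2 = x ^ 2 - 2 * (ν + μ) * x + (ν + μ) ^ 2 := by ring
  have hi₃ : Integrable (fun x ↦ x ^ 2 - 2 * (ν + μ) * x) (noncentralChiSq ν μ) :=
    hi₂.sub (hi₁.const_mul _)
  simp only [hexp]
  rw [integral_add hi₃ (integrable_const _), integral_sub hi₂ (hi₁.const_mul _), integral_const_mul, h₁, h₂]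
  simp
  ring

end NoncentralChiSq

/-- Mean and variance of the exact Cox–Ingersoll–Ross transition. -/
theorem cirTransition_mean_variance (a t θ₀ : ℝ) (ha : 0 < a) (ht : 0 < t)
    (hθ : 0 ≤ θ₀) :
    (∫ x, x ∂(cirTransition a t θ₀) = θ₀ * Real.exp (-t) + a * (1 - Real.exp (-t))) ∧
      ∫ x, (x - (θ₀ * Real.exp (-t) + a * (1 - Real.exp (-t)))) ^ 2
          ∂(cirTransition a t θ₀) =
        2 * θ₀ * (Real.exp (-t) - Real.exp (-2 * t)) + a * (1 - Real.exp (-t)) ^ 2 := by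
  have hc : 0 < 1 - exp (-t) := by simpa using ht
  have hmap (f : ℝ → ℝ) (hf : Measurable f) : ∫ x, f x ∂(cirTransition a t θ₀) =
      ∫ w, f ((1 - exp (-t)) / 2 * w) ∂(noncentralChiSq (2 * a)
        (2 * θ₀ * exp (-t) / (1 - exp (-t)))) :=
    integral_map (by fun_prop) hf.aestronglyMeasurable
  set μ := 2 * θ₀ * exp (-t) / (1 - exp (-t)) with hμ_def
  have hμ : 0 ≤ μ := by positivity
  have hν : 0 < 2 * a := by positivity
  have hcμ : (1 - exp (-t)) * μ = 2 * θ₀ * exp (-t) := by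
    rw [hμ_def]
    field_simp
  constructor
  · rw [hmap (fun x ↦ x) measurable_id, integral_const_mul,
      (integrable_and_integral_id_noncentralChiSq hν hμ).2]
    linear_combination hcμ / 2
  · rw [hmap (fun x ↦ (x - (θ₀ * exp (-t) + a * (1 - exp (-t)))) ^ 2) (by fun_prop)]
    have hscale (w : ℝ) :
        ((1 - exp (-t)) / 2 * w - (θ₀ * exp (-t) + a * (1 - exp (-t)))) ^ 2 =
          ((1 - exp (-t)) / 2) ^ 2 * (w - (2 * a + μ)) ^ 2 := by
      rw [← mul_pow]
      congr 1
      linear_combination hcμ / 2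
    have hexp : exp (-2 * t) = exp (-t) ^ 2 := by
      rw [← exp_nat_mul]
      congr 1
      push_cast
      ring
    simp only [hscale]
    rw [integral_const_mul, integral_sub_sq_noncentralChiSq hν hμ, hexp]
    linear_combination (1 - exp (-t)) * hcμ
end

section
/- Let M ≥ 1 be an integer, h > 0, and b₁, …, b_M be nonzero real numbers. For 1 ≤ j ≤ M define r_j(s) = s b_j e^{-b_j h} / (b_j − s(1 − e^{-b_j h})), and for 1 ≤ j ≤ M + 1 define D_j(s) = 1 − s Σ_{l=1}^{M−j+1} ((1 − e^{-h b_{M−l+1}})/b_{M−l+1}) · e^{-h Σ_{i=M−l+2}^{M} b_i} (so D_{M+1}(s) = 1, and the inner exponent sum is empty when l = 1). Fix 1 ≤ m ≤ M and a real s such that D_j(s) ≠ 0 for all m ≤ j ≤ M + 1. Then (r_m ∘ r_{m+1} ∘ ⋯ ∘ r_M)(s) = s e^{-h Σ_{j=m}^{M} b_j} / D_m(s). -/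
open Finset Real

/-- One-step map of the control variate-based stochastic Cox–Ingersoll–Ross process
(alternative parametrization): `r_j(s) = s b_j e^{-b_j h} / (b_j − s(1 − e^{-b_j h}))`. -/
noncomputable def scirRAlt (h : ℝ) (b : ℕ → ℝ) (j : ℕ) (s : ℝ) : ℝ :=
  s * b j * Real.exp (-(b j) * h) / (b j - s * (1 - Real.exp (-(b j) * h)))

/-- Denominator of the alternative parametrization:
`D_j(s) = 1 − s Σ_{l=1}^{M−j+1} ((1 − e^{-h b_{M−l+1}})/b_{M−l+1}) e^{-h Σ_{i=M−l+2}^{M} b_i}`,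
with the convention `D_{M+1}(s) = 1` (empty sum), the inner exponent sum being empty
when `l = 1`. -/
noncomputable def scirDAlt (h : ℝ) (b : ℕ → ℝ) (M j : ℕ) (s : ℝ) : ℝ :=
  1 - s * ∑ l ∈ Finset.Icc 1 (M + 1 - j),
      ((1 - Real.exp (-h * b (M - l + 1))) / b (M - l + 1)) *
        Real.exp (-h * ∑ i ∈ Finset.Icc (M - l + 2) M, b i)

theorem scirDAlt_eq_sub (h : ℝ) (b : ℕ → ℝ) {M j : ℕ} (hj1 : 1 ≤ j) (hjM : j ≤ M) (s : ℝ) :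
    scirDAlt h b M j s = scirDAlt h b M (j + 1) s -
      s * ((1 - Real.exp (-h * b j)) / b j *
        Real.exp (-h * ∑ i ∈ Finset.Icc (j + 1) M, b i)) := by
  have hlen : M + 1 - j = (M + 1 - (j + 1)) + 1 := by omega
  have hidx : M - (M + 1 - (j + 1) + 1) + 1 = j := by omega
  have hidx' : M - (M + 1 - (j + 1) + 1) + 2 = j + 1 := by omega
  unfold scirDAlt
  rw [hlen, Finset.sum_Icc_succ_top (by omega), hidx, hidx']
  ring

theorem scirRAlt_div (h : ℝ) (b : ℕ → ℝ) (j : ℕ) (hb : b j ≠ 0) (x : ℝ) {D : ℝ} (hD : D ≠ 0) :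
    scirRAlt h b j (x / D) =
      x * Real.exp (-h * b j) / (D - x * ((1 - Real.exp (-h * b j)) / b j)) := by
  have hden : b j - x / D * (1 - Real.exp (-h * b j)) =
      (D - x * ((1 - Real.exp (-h * b j)) / b j)) * (b j / D) := by
    field_simp
  have hexp : -(b j) * h = -h * b j := by ring
  have hnum : x / D * b j * Real.exp (-h * b j) = x * Real.exp (-h * b j) * (b j / D) := by
    ring
  rw [scirRAlt, hexp, hden, hnum, mul_div_mul_right _ _ (div_ne_zero hb hD)]

theorem iterComp_scirRAlt (M : ℕ) (h : ℝ) (b : ℕ → ℝ)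
    (hb : ∀ j, 1 ≤ j → j ≤ M → b j ≠ 0) (s : ℝ) (k m : ℕ) (hm : 1 ≤ m) (hk : m + k = M + 1)
    (hD : ∀ j, m ≤ j → j ≤ M + 1 → scirDAlt h b M j s ≠ 0) :
    iterComp (scirRAlt h b) m k s =
      s * Real.exp (-h * ∑ j ∈ Finset.Icc m M, b j) / scirDAlt h b M m s := by
  induction k generalizing m with
  | zero =>
    obtain rfl : m = M + 1 := by omega
    simp [iterComp, scirDAlt]
  | succ k ih =>
    have hmM : m ≤ M := by omega
    rw [iterComp, ih (m + 1) (by omega) (by omega) fun j hj => hD j (by omega),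
      scirRAlt_div h b m (hb m hm hmM) _ (hD (m + 1) (by omega) (by omega)),
      scirDAlt_eq_sub h b hm hmM, ← Finset.add_sum_Ioc_eq_sum_Icc hmM,
      ← Finset.Icc_add_one_left_eq_Ioc, mul_add, Real.exp_add]
    congr 1 <;> ring

theorem scirRAlt_comp (M : ℕ) (hM : 1 ≤ M) (h : ℝ) (hh : 0 < h) (b : ℕ → ℝ)
    (hb : ∀ j, 1 ≤ j → j ≤ M → b j ≠ 0) (m : ℕ) (hm1 : 1 ≤ m) (hm2 : m ≤ M) (s : ℝ)
    (hD : ∀ j, m ≤ j → j ≤ M + 1 → scirDAlt h b M j s ≠ 0) :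
    iterComp (scirRAlt h b) m (M - m + 1) s =
      s * Real.exp (-h * ∑ j ∈ Finset.Icc m M, b j) / scirDAlt h b M m s := by
  exact iterComp_scirRAlt M h b hb s (M - m + 1) m hm1 (by omega) hD
end
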